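/- Let 𝒦 be a cartesian closed category, D an object of 𝒦, and 𝒦[x] the polynomial cartesian closed category obtained by adjoining an indeterminate x : 𝖳 ⊢ D. Then for every arrow [f] : A ⊢ B of 𝒦[x], Φ′ₓ(Γ′_{x,B}𝟏_{D×B} ∘ [f]) = ⟨p¹_{D,A}, Φ′ₓf⟩ in 𝒦, where Γ′_{x,B}h = [h] ∘ ⟨[x]∘k_B, 𝟏_B⟩ for h : D×B ⊢ C in 𝒦. -/

import Mathlib

/-! Equational presentation of cartesian closed categories (Lambek/Došen style),
the polynomial extension `K[x]` by an indeterminate `x : T ⊢ D`, and the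
functional-completeness apparatus. -/

universe u v

/-- A cartesian closed category presented equationally ("CC category"):
a deductive system with terminal object `T`, products, exponentials,
the arrows `k`, `p¹`, `p²`, `ε`, the operations of pairing and currying,
satisfying the categorial and cartesian closed equalities. -/
structure CC : Type (max (u + 1) (v + 1)) where
  Obj : Type u
  Hom : Obj → Obj → Type v
  id : ∀ A, Hom A A
  /-- `comp g f` is `g ∘ f`. -/
  comp : ∀ {A B C}, Hom B C → Hom A B → Hom A C
  T : Obj
  prod : Obj → Obj → Obj
  exp : Obj → Obj → Obj
  k : ∀ A, Hom A T
  p1 : ∀ A B, Hom (prod A B) A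
  p2 : ∀ A B, Hom (prod A B) B
  eval : ∀ A B, Hom (prod A (exp A B)) B
  pair : ∀ {C A B}, Hom C A → Hom C B → Hom C (prod A B)
  curry : ∀ {A B C}, Hom (prod A C) B → Hom C (exp A B)
  comp_id : ∀ {A B} (f : Hom A B), comp f (id A) = f
  id_comp : ∀ {A B} (f : Hom A B), comp (id B) f = f
  assoc : ∀ {A B C E} (f : Hom A B) (g : Hom B C) (h : Hom C E),
    comp h (comp g f) = comp (comp h g) f
  T_eta : ∀ {A} (f : Hom A T), f = k A
  prod_beta1 : ∀ {C A B} (f1 : Hom C A) (f2 : Hom C B),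
    comp (p1 A B) (pair f1 f2) = f1
  prod_beta2 : ∀ {C A B} (f1 : Hom C A) (f2 : Hom C B),
    comp (p2 A B) (pair f1 f2) = f2
  prod_eta : ∀ {C A B} (h : Hom C (prod A B)),
    pair (comp (p1 A B) h) (comp (p2 A B) h) = h
  /-- (→β):  φ_{A,B} (γ_{A,C} f) = f, with φ g = ε ∘ (1 × g). -/
  exp_beta : ∀ {A B C} (f : Hom (prod A C) B),
    comp (eval A B) (pair (comp (id A) (p1 A C)) (comp (curry f) (p2 A C))) = f
  /-- (→η):  γ_{A,C} (φ_{A,B} g) = g. -/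
  exp_eta : ∀ {A B C} (g : Hom C (exp A B)),
    curry (comp (eval A B) (pair (comp (id A) (p1 A C)) (comp g (p2 A C)))) = g

namespace CC

variable (K : CC)

/-- `f × g = ⟨f ∘ p¹, g ∘ p²⟩`. -/
def prodMap {A B C E : K.Obj} (f : K.Hom A B) (g : K.Hom C E) :
    K.Hom (K.prod A C) (K.prod B E) :=
  K.pair (K.comp f (K.p1 A C)) (K.comp g (K.p2 A C))

/-- `φ_{A,B} g = ε_{A,B} ∘ (1_A × g)` for `g : C ⊢ A → B`. -/
def phi {A B C : K.Obj} (g : K.Hom C (K.exp A B)) : K.Hom (K.prod A C) B :=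
  K.comp (K.eval A B) (K.prodMap (K.id A) g)

/-- `f → g = γ (g ∘ ε ∘ (f × 1))` for `f : A ⊢ B`, `g : C ⊢ E`. -/
def expMap {A B C E : K.Obj} (f : K.Hom A B) (g : K.Hom C E) :
    K.Hom (K.exp B C) (K.exp A E) :=
  K.curry (K.comp g (K.comp (K.eval B C) (K.prodMap f (K.id (K.exp B C)))))

/-- `b⃖_{A,B,C} = ⟨p¹ ∘ p¹, p² × 1⟩ : (A×B)×C ⊢ A×(B×C)`. -/
def bl (A B C : K.Obj) : K.Hom (K.prod (K.prod A B) C) (K.prod A (K.prod B C)) :=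
  K.pair (K.comp (K.p1 A B) (K.p1 (K.prod A B) C)) (K.prodMap (K.p2 A B) (K.id C))

/-- `b⃗_{A,B,C} = ⟨1 × p¹, p² ∘ p²⟩ : A×(B×C) ⊢ (A×B)×C`. -/
def br (A B C : K.Obj) : K.Hom (K.prod A (K.prod B C)) (K.prod (K.prod A B) C) :=
  K.pair (K.prodMap (K.id A) (K.p1 B C)) (K.comp (K.p2 B C) (K.p2 A (K.prod B C)))

/-- `c_{A,B} = ⟨p², p¹⟩ : A×B ⊢ B×A`. -/
def cswap (A B : K.Obj) : K.Hom (K.prod A B) (K.prod B A) :=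
  K.pair (K.p2 A B) (K.p1 A B)

end CC

/-- Arrow terms of the CC system `𝒮` obtained from `K` by adjoining an
indeterminate arrow `x : T ⊢ D`: generated from `x` and the arrows of `K`
by formal composition, formal pairing and formal currying. -/
inductive Tm (K : CC.{u, v}) (D : K.Obj) : K.Obj → K.Obj → Type (max u v)
  | x : Tm K D K.T D
  | arr : ∀ {A B : K.Obj}, K.Hom A B → Tm K D A B
  | comp : ∀ {A B C : K.Obj}, Tm K D B C → Tm K D A B → Tm K D A C
  | pair : ∀ {C A B : K.Obj}, Tm K D C A → Tm K D C B → Tm K D C (K.prod A B)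
  | curry : ∀ {A B C : K.Obj}, Tm K D (K.prod A C) B → Tm K D C (K.exp A B)

namespace Tm

/-- Formal `φ_{A,B}` on arrow terms: `φ g = ε ∘ (1 × g)`. -/
def phiS {K : CC.{u, v}} {D : K.Obj} {A B C : K.Obj} (g : Tm K D C (K.exp A B)) :
    Tm K D (K.prod A C) B :=
  Tm.comp (.arr (K.eval A B))
    (Tm.pair (Tm.comp (.arr (K.id A)) (.arr (K.p1 A C)))
      (Tm.comp g (.arr (K.p2 A C))))

end Tm

/-- The smallest CC equivalence relation `≡` on arrow terms of `𝒮`: an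
equivalence relation which is a congruence for the formal operations,
contains all instances of the categorial and cartesian closed equalities,
and identifies the formal operations applied to arrows of `K` with the
corresponding operations of `K`. -/
inductive Eqv (K : CC.{u, v}) (D : K.Obj) : ∀ {A B : K.Obj}, Tm K D A B → Tm K D A B → Prop
  | refl {A B : K.Obj} (f : Tm K D A B) : Eqv K D f f
  | symm {A B : K.Obj} {f g : Tm K D A B} : Eqv K D f g → Eqv K D g f
  | trans {A B : K.Obj} {f g h : Tm K D A B} :
      Eqv K D f g → Eqv K D g h → Eqv K D f h
  | comp_congr {A B C : K.Obj} {g g' : Tm K D B C} {f f' : Tm K D A B} :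
      Eqv K D g g' → Eqv K D f f' → Eqv K D (.comp g f) (.comp g' f')
  | pair_congr {C A B : K.Obj} {f1 f1' : Tm K D C A} {f2 f2' : Tm K D C B} :
      Eqv K D f1 f1' → Eqv K D f2 f2' → Eqv K D (.pair f1 f2) (.pair f1' f2')
  | curry_congr {A B C : K.Obj} {f f' : Tm K D (K.prod A C) B} :
      Eqv K D f f' → Eqv K D (.curry f) (.curry f')
  | comp_id {A B : K.Obj} (f : Tm K D A B) :
      Eqv K D (.comp f (.arr (K.id A))) f
  | id_comp {A B : K.Obj} (f : Tm K D A B) :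
      Eqv K D (.comp (.arr (K.id B)) f) f
  | assoc {A B C E : K.Obj} (f : Tm K D A B) (g : Tm K D B C) (h : Tm K D C E) :
      Eqv K D (.comp h (.comp g f)) (.comp (.comp h g) f)
  | T_eta {A : K.Obj} (f : Tm K D A K.T) : Eqv K D f (.arr (K.k A))
  | prod_beta1 {C A B : K.Obj} (f1 : Tm K D C A) (f2 : Tm K D C B) :
      Eqv K D (.comp (.arr (K.p1 A B)) (.pair f1 f2)) f1
  | prod_beta2 {C A B : K.Obj} (f1 : Tm K D C A) (f2 : Tm K D C B) :
      Eqv K D (.comp (.arr (K.p2 A B)) (.pair f1 f2)) f2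
  | prod_eta {C A B : K.Obj} (h : Tm K D C (K.prod A B)) :
      Eqv K D (.pair (.comp (.arr (K.p1 A B)) h) (.comp (.arr (K.p2 A B)) h)) h
  | exp_beta {A B C : K.Obj} (f : Tm K D (K.prod A C) B) :
      Eqv K D (Tm.phiS (.curry f)) f
  | exp_eta {A B C : K.Obj} (g : Tm K D C (K.exp A B)) :
      Eqv K D (.curry (Tm.phiS g)) g
  | arr_comp {A B C : K.Obj} (f : K.Hom A B) (g : K.Hom B C) :
      Eqv K D (.comp (.arr g) (.arr f)) (.arr (K.comp g f))
  | arr_pair {C A B : K.Obj} (f1 : K.Hom C A) (f2 : K.Hom C B) :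
      Eqv K D (.pair (.arr f1) (.arr f2)) (.arr (K.pair f1 f2))
  | arr_curry {A B C : K.Obj} (f : K.Hom (K.prod A C) B) :
      Eqv K D (.curry (.arr f)) (.arr (K.curry f))

instance tmSetoid (K : CC.{u, v}) (D : K.Obj) (A B : K.Obj) : Setoid (Tm K D A B) :=
  ⟨Eqv K D, ⟨Eqv.refl, Eqv.symm, Eqv.trans⟩⟩

/-- Hom-sets of the polynomial category `K[x]`: `≡`-equivalence classes of
arrow terms of `𝒮`. -/
def KxHom (K : CC.{u, v}) (D : K.Obj) (A B : K.Obj) : Type (max u v) :=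
  Quotient (tmSetoid K D A B)

/-- `[f]`, the `≡`-class of an arrow term `f`. -/
def cls {K : CC.{u, v}} {D A B : K.Obj} (f : Tm K D A B) : KxHom K D A B :=
  Quotient.mk (tmSetoid K D A B) f

/-- The polynomial cartesian closed category `K[x]`: same objects as `K`,
arrows the `≡`-classes, all structure induced classwise. -/
def Kx (K : CC.{u, v}) (D : K.Obj) : CC.{u, max u v} where
  Obj := K.Obj
  Hom := KxHom K D
  id A := cls (.arr (K.id A))
  comp g f :=
    Quotient.map₂ Tm.comp (fun _ _ hg _ _ hf => Eqv.comp_congr hg hf) g f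
  T := K.T
  prod := K.prod
  exp := K.exp
  k A := cls (.arr (K.k A))
  p1 A B := cls (.arr (K.p1 A B))
  p2 A B := cls (.arr (K.p2 A B))
  eval A B := cls (.arr (K.eval A B))
  pair f1 f2 :=
    Quotient.map₂ Tm.pair (fun _ _ h1 _ _ h2 => Eqv.pair_congr h1 h2) f1 f2
  curry f := Quotient.map Tm.curry (fun _ _ h => Eqv.curry_congr h) f
  comp_id f := Quotient.inductionOn f fun t => Quotient.sound (Eqv.comp_id t)
  id_comp f := Quotient.inductionOn f fun t => Quotient.sound (Eqv.id_comp t)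
  assoc f g h :=
    Quotient.inductionOn₃ f g h fun f g h => Quotient.sound (Eqv.assoc f g h)
  T_eta f := Quotient.inductionOn f fun t => Quotient.sound (Eqv.T_eta t)
  prod_beta1 f1 f2 :=
    Quotient.inductionOn₂ f1 f2 fun t1 t2 => Quotient.sound (Eqv.prod_beta1 t1 t2)
  prod_beta2 f1 f2 :=
    Quotient.inductionOn₂ f1 f2 fun t1 t2 => Quotient.sound (Eqv.prod_beta2 t1 t2)
  prod_eta h := Quotient.inductionOn h fun t => Quotient.sound (Eqv.prod_eta t)
  exp_beta f := Quotient.inductionOn f fun t => Quotient.sound (Eqv.exp_beta t)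
  exp_eta g := Quotient.inductionOn g fun t => Quotient.sound (Eqv.exp_eta t)

/-- The heritage map: identity on objects, `H f = [f]` on arrows. -/
def Hmap (K : CC.{u, v}) (D : K.Obj) {A B : K.Obj} (f : K.Hom A B) : KxHom K D A B :=
  cls (.arr f)

namespace Tm

/-- `Φ′ₓ`, defined by recursion on arrow terms `f : A ⊢ B` of `𝒮`,
with `Φ′ₓ f : D×A ⊢ B` an arrow of `K`. -/
def phiP {K : CC.{u, v}} {D : K.Obj} : {A B : K.Obj} → Tm K D A B → K.Hom (K.prod D A) B
  | _, _, .x => K.p1 D K.T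
  | A, _, .arr f => K.comp f (K.p2 D A)
  | A, _, .comp g f => K.comp (phiP g) (K.pair (K.p1 D A) (phiP f))
  | _, _, .pair f1 f2 => K.pair (phiP f1) (phiP f2)
  | C, _, @Tm.curry _ _ A B _ f =>
      K.curry (K.comp (phiP f)
        (K.comp (K.bl D A C)
          (K.comp (K.prodMap (K.cswap A D) (K.id C)) (K.br A D C))))

end Tm

/-- The canonical arrow term representing `Γ′_{x,A} f = [f] ∘ ⟨[x] ∘ k_A, 1_A⟩`. -/
def gammaTm (K : CC.{u, v}) (D : K.Obj) {A B : K.Obj} (f : K.Hom (K.prod D A) B) :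
    Tm K D A B :=
  Tm.comp (.arr f) (Tm.pair (Tm.comp Tm.x (.arr (K.k A))) (.arr (K.id A)))

/-- `Γ′_{x,A} f = [f] ∘ ⟨[x] ∘ k_A, 1_A⟩ : A ⊢ B` in `K[x]`,
for `f : D×A ⊢ B` in `K`. -/
def gammaP (K : CC.{u, v}) (D : K.Obj) {A B : K.Obj} (f : K.Hom (K.prod D A) B) :
    KxHom K D A B :=
  (Kx K D).comp (cls (.arr f))
    ((Kx K D).pair ((Kx K D).comp (cls Tm.x) ((Kx K D).k A)) ((Kx K D).id A))

/-- A strict cartesian closed functor between CC categories: preserves the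
terminal object, products, exponentials, `k`, `p¹`, `p²`, `ε`, pairing and
currying on the nose (heterogeneous equality is used across the object
identifications). -/
structure CCFunctor (K L : CC) where
  obj : K.Obj → L.Obj
  map : ∀ {A B : K.Obj}, K.Hom A B → L.Hom (obj A) (obj B)
  map_id : ∀ A, map (K.id A) = L.id (obj A)
  map_comp : ∀ {A B C : K.Obj} (f : K.Hom A B) (g : K.Hom B C),
    map (K.comp g f) = L.comp (map g) (map f)
  obj_T : obj K.T = L.T
  obj_prod : ∀ A B, obj (K.prod A B) = L.prod (obj A) (obj B)
  obj_exp : ∀ A B, obj (K.exp A B) = L.exp (obj A) (obj B)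
  map_k : ∀ A, HEq (map (K.k A)) (L.k (obj A))
  map_p1 : ∀ A B, HEq (map (K.p1 A B)) (L.p1 (obj A) (obj B))
  map_p2 : ∀ A B, HEq (map (K.p2 A B)) (L.p2 (obj A) (obj B))
  map_eval : ∀ A B, HEq (map (K.eval A B)) (L.eval (obj A) (obj B))
  map_pair : ∀ {C A B : K.Obj} (f1 : K.Hom C A) (f2 : K.Hom C B),
    HEq (map (K.pair f1 f2)) (L.pair (map f1) (map f2))
  map_curry : ∀ {A B C : K.Obj} (f : K.Hom (K.prod A C) B)
    (g : L.Hom (L.prod (obj A) (obj C)) (obj B)), HEq (map f) g →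
    HEq (map (K.curry f)) (L.curry g)

namespace CC

variable (K : CC.{u, v})

theorem pair_comp {A B C E : K.Obj} (f : K.Hom C A) (g : K.Hom C B) (h : K.Hom E C) :
    K.comp (K.pair f g) h = K.pair (K.comp f h) (K.comp g h) := by
  rw [← K.prod_eta (K.comp (K.pair f g) h), K.assoc, K.assoc, K.prod_beta1, K.prod_beta2]

theorem pair_p1_p2 (A B : K.Obj) : K.pair (K.p1 A B) (K.p2 A B) = K.id (K.prod A B) := by
  simpa only [K.comp_id] using K.prod_eta (K.id (K.prod A B))

theorem eval_pair_curry_comp {A B C E : K.Obj} (f : K.Hom (K.prod A C) B)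
    (a : K.Hom E A) (b : K.Hom E C) :
    K.comp (K.eval A B) (K.pair a (K.comp (K.curry f) b)) = K.comp f (K.pair a b) := by
  conv_rhs => rw [← K.exp_beta f]
  simp only [← K.assoc, pair_comp, K.prod_beta1, K.prod_beta2, K.id_comp]

theorem curry_eval_pair {A B C : K.Obj} (g : K.Hom C (K.exp A B)) :
    K.curry (K.comp (K.eval A B) (K.pair (K.p1 A C) (K.comp g (K.p2 A C)))) = g := by
  simpa only [K.id_comp] using K.exp_eta g

theorem curry_comp {A B C E : K.Obj} (f : K.Hom (K.prod A C) B) (h : K.Hom E C) :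
    K.comp (K.curry f) h = K.curry (K.comp f (K.pair (K.p1 A E) (K.comp h (K.p2 A E)))) := by
  rw [← K.curry_eval_pair (K.comp (K.curry f) h), ← K.assoc, eval_pair_curry_comp]

/-- The permutation of factors used in the currying clause of `Φ′ₓ`, in projection form. -/
theorem bl_comp_cswap_comp_br (A C D : K.Obj) :
    K.comp (K.bl D A C) (K.comp (K.prodMap (K.cswap A D) (K.id C)) (K.br A D C)) =
      K.pair (K.comp (K.p1 D C) (K.p2 A (K.prod D C)))
        (K.pair (K.p1 A (K.prod D C)) (K.comp (K.p2 D C) (K.p2 A (K.prod D C)))) := by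
  simp only [bl, br, prodMap, cswap, ← K.assoc, pair_comp, K.prod_beta1, K.prod_beta2, K.id_comp]

end CC

theorem Eqv.phiP_eq {K : CC.{u, v}} {D A B : K.Obj} {f g : Tm K D A B} (h : Eqv K D f g) :
    f.phiP = g.phiP := by
  induction h with
  | refl => rfl
  | symm _ ih => exact ih.symm
  | trans _ _ ih₁ ih₂ => exact ih₁.trans ih₂
  | comp_congr _ _ ih₁ ih₂ => simp only [Tm.phiP, ih₁, ih₂]
  | pair_congr _ _ ih₁ ih₂ => simp only [Tm.phiP, ih₁, ih₂]
  | curry_congr _ ih => simp only [Tm.phiP, ih]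
  | T_eta f => exact (K.T_eta _).trans (K.T_eta _).symm
  | exp_beta f =>
    simp only [Tm.phiP, Tm.phiS, K.bl_comp_cswap_comp_br, ← K.assoc, K.pair_comp, K.prod_beta1,
      K.prod_beta2, K.id_comp, K.comp_id, K.prod_eta, K.pair_p1_p2, K.eval_pair_curry_comp]
  | _ =>
    simp only [Tm.phiP, Tm.phiS, K.bl_comp_cswap_comp_br, ← K.assoc, K.pair_comp, K.prod_beta1,
      K.prod_beta2, K.id_comp, K.comp_id, K.prod_eta, K.pair_p1_p2, K.curry_eval_pair,
      K.curry_comp]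

/-- for every arrow `[f] : A ⊢ B` of `K[x]`,
`Φ′ₓ(Γ′_{x,B} 1_{D×B} ∘ [f]) = ⟨p¹_{D,A}, Φ′ₓ f⟩` in `K`. -/
theorem statement9 (K : CC.{u, v}) (D : K.Obj) :
    ∃ PhiQ : ∀ (A B : K.Obj), KxHom K D A B → K.Hom (K.prod D A) B,
      (∀ (A B : K.Obj) (t : Tm K D A B), PhiQ A B (cls t) = t.phiP) ∧
      (∀ (A B : K.Obj) (h : KxHom K D A B),
        PhiQ A (K.prod D B) ((Kx K D).comp (gammaP K D (K.id (K.prod D B))) h) =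
          K.pair (K.p1 D A) (PhiQ A B h)) := by
  refine ⟨fun A B => Quotient.lift Tm.phiP fun _ _ h => Eqv.phiP_eq h, fun _ _ _ => rfl,
    fun A B h => Quotient.inductionOn h fun t => ?_⟩
  change K.comp (gammaTm K D (K.id (K.prod D B))).phiP (K.pair (K.p1 D A) t.phiP) =
    K.pair (K.p1 D A) t.phiP
  simp only [gammaTm, Tm.phiP, K.pair_comp, K.prod_beta1, K.prod_beta2, K.id_comp]
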